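/- arXiv:2112.13143 — 6 statements merged into one kernel-verified Lean document; each statement's English description precedes it below -/
import Mathlib

section
/- Subgraph edit distance satisfies the triangle inequality: for all labelled graphs G₁, G₂, G₃ (with the binary label cost), SED(G₁, G₃) ≤ SED(G₁, G₂) + SED(G₂, G₃). -/
open scoped BigOperators

/-- A labelled undirected graph: a finite set of nodes (drawn from the universe `ℕ`),
a finite set of undirected edges on these nodes, and labels in `α` on nodes and edges.
`ε` is the special empty label, which no real node or edge carries. -/
structure LGraph (α : Type) (ε : α) where
  V : Finset ℕ
  E : Finset (Sym2 ℕ)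
  edge_mem : ∀ e ∈ E, ∀ v ∈ e, v ∈ V
  Lv : ℕ → α
  Le : Sym2 ℕ → α
  Lv_ne : ∀ v ∈ V, Lv v ≠ ε
  Le_ne : ∀ e ∈ E, Le e ≠ ε

variable {α : Type} {ε : α}

/-- A graph mapping between `G₁` and `G₂`: a bijection between the extended graphs
(obtained by adding dummy ε-labelled nodes and edges) in which no dummy is matched with a
dummy.  It is encoded by the set `dom` of nodes of `G₁` matched to real nodes of `G₂`
together with the (injective) matching function `f`; nodes of `G₁` outside `dom` are
matched with dummy nodes (deleted), nodes of `G₂` outside `f '' dom` are images of dummy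
nodes (inserted).  The induced mapping of edges sends `e ∈ E₁` to `Sym2.map f e`, which is
a real edge of `G₂` precisely when both endpoints are matched and the image is in `E₂`. -/
structure GMap (G₁ G₂ : LGraph α ε) where
  dom : Finset ℕ
  dom_sub : dom ⊆ G₁.V
  f : ℕ → ℕ
  maps_to : ∀ v ∈ dom, f v ∈ G₂.V
  injOn : ∀ v ∈ dom, ∀ w ∈ dom, f v = f w → v = w

-- The edges of `G₁` matched with real edges of `G₂` under the mapping.
open Classical in
noncomputable def GMap.matchedEdges {G₁ G₂ : LGraph α ε} (π : GMap G₁ G₂) :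
    Finset (Sym2 ℕ) :=
  G₁.E.filter fun e => (∀ v ∈ e, v ∈ π.dom) ∧ e.map π.f ∈ G₂.E

-- The cost `GED_π(G₁,G₂)` of a graph mapping `π` under label cost `d`:
-- the sum over all (extended) nodes of `d(L(v), L(π v))` plus the sum over all (extended)
-- edges of `d(L(e), L(π e))`; dummy nodes and edges carry the label `ε`.
open Classical in
noncomputable def GMap.cost (d : α → α → ℝ) {G₁ G₂ : LGraph α ε} (π : GMap G₁ G₂) : ℝ :=
  (∑ v ∈ π.dom, d (G₁.Lv v) (G₂.Lv (π.f v)))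
    + (∑ v ∈ G₁.V \ π.dom, d (G₁.Lv v) ε)
    + (∑ w ∈ G₂.V \ π.dom.image π.f, d ε (G₂.Lv w))
    + (∑ e ∈ π.matchedEdges, d (G₁.Le e) (G₂.Le (e.map π.f)))
    + (∑ e ∈ G₁.E \ π.matchedEdges, d (G₁.Le e) ε)
    + (∑ e ∈ G₂.E \ π.matchedEdges.image (Sym2.map π.f), d ε (G₂.Le e))

/-- Graph edit distance under label cost `d`: the minimum of `GED_π` over all mappings. -/
noncomputable def GED (d : α → α → ℝ) (G₁ G₂ : LGraph α ε) : ℝ :=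
  sInf { c | ∃ π : GMap G₁ G₂, c = π.cost d }

/-- `S` is a subgraph of `G`. -/
def IsSubgraph (S G : LGraph α ε) : Prop :=
  S.V ⊆ G.V ∧ S.E ⊆ G.E ∧ (∀ v ∈ S.V, S.Lv v = G.Lv v) ∧ (∀ e ∈ S.E, S.Le e = G.Le e)

/-- Subgraph edit distance: the minimum of `GED(G₁, S)` over all subgraphs `S ⊆ G₂`. -/
noncomputable def SED (d : α → α → ℝ) (G₁ G₂ : LGraph α ε) : ℝ :=
  sInf { c | ∃ S : LGraph α ε, IsSubgraph S G₂ ∧ c = GED d G₁ S }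

-- The binary label cost: `1` on distinct labels, `0` on equal labels.
open Classical in
noncomputable def dBin (α : Type) : α → α → ℝ := fun a b => if a = b then 0 else 1

-- The modified label cost ignoring insertions.
open Classical in
noncomputable def dHat (ε : α) (d : α → α → ℝ) : α → α → ℝ :=
  fun a b => if a = ε then 0 else d a b

lemma dBin_nonneg (a b : α) : 0 ≤ dBin α a b := by
  unfold dBin; split_ifs <;> norm_num

lemma dBin_tri (a b c : α) : dBin α a c ≤ dBin α a b + dBin α b c := by
  unfold dBin
  by_cases h1 : a = b <;> by_cases h2 : b = c <;> by_cases h3 : a = c <;> simp_all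

/-- A sum split along a subset, written as a single sum. -/
lemma sum_split {ι : Type} [DecidableEq ι] (A D : Finset ι) (h : D ⊆ A) (p q : ι → ℝ) :
    ∑ v ∈ A, (if v ∈ D then p v else q v) = ∑ v ∈ D, p v + ∑ v ∈ A \ D, q v := by
  rw [← Finset.sum_sdiff h, add_comm]
  congr 1
  · exact Finset.sum_congr rfl fun v hv => by simp [hv]
  · exact Finset.sum_congr rfl fun v hv => by simp [(Finset.mem_sdiff.1 hv).2]

/-- Composition of partial matchings: deletion and relabelling costs are subadditive. -/
lemma comp_bound {ι : Type} [DecidableEq ι] (ε : α) (A₁ D₁ A₂ D₂ D : Finset ι) (f g : ι → ι) (l₁ l₂ l₃ : ι → α)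
    (hs₁ : D₁ ⊆ A₁) (hf : ∀ v ∈ D₁, f v ∈ A₂) (hi : ∀ v ∈ D₁, ∀ w ∈ D₁, f v = f w → v = w)
    (hs₂ : D₂ ⊆ A₂) (hD : ∀ v, v ∈ D ↔ v ∈ D₁ ∧ f v ∈ D₂) :
    ∑ v ∈ D, dBin α (l₁ v) (l₃ (g (f v))) + ∑ v ∈ A₁ \ D, dBin α (l₁ v) ε ≤
      (∑ v ∈ D₁, dBin α (l₁ v) (l₂ (f v)) + ∑ v ∈ A₁ \ D₁, dBin α (l₁ v) ε) +
      (∑ w ∈ D₂, dBin α (l₂ w) (l₃ (g w)) + ∑ w ∈ A₂ \ D₂, dBin α (l₂ w) ε) := by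
  have hDA : D ⊆ A₁ := fun v hv => hs₁ ((hD v).1 hv).1
  rw [← sum_split A₁ D hDA, ← sum_split A₁ D₁ hs₁, ← sum_split A₂ D₂ hs₂]
  set h : ι → ℝ := fun w => if w ∈ D₂ then dBin α (l₂ w) (l₃ (g w)) else dBin α (l₂ w) ε with hh
  have hpos : ∀ w, 0 ≤ h w := fun w => by
    simp only [hh]; split_ifs <;> exact dBin_nonneg _ _
  have h1 : ∑ v ∈ D₁, h (f v) ≤ ∑ w ∈ A₂, h w := by
    rw [← Finset.sum_image (f := h) (g := f) (s := D₁) (fun v hv w hw e => hi v hv w hw e)]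
    apply Finset.sum_le_sum_of_subset_of_nonneg
    · intro w hw
      obtain ⟨v, hv, rfl⟩ := Finset.mem_image.1 hw
      exact hf v hv
    · intro w _ _; exact hpos w
  have h2 : ∑ v ∈ D₁, h (f v) = ∑ v ∈ A₁, (if v ∈ D₁ then h (f v) else 0) := by
    rw [sum_split A₁ D₁ hs₁]; simp
  refine le_trans ?_ (add_le_add_right h1 _)
  rw [h2, ← Finset.sum_add_distrib]
  apply Finset.sum_le_sum
  intro v _
  by_cases hv : v ∈ D₁
  · by_cases hw : f v ∈ D₂
    · have : v ∈ D := (hD v).2 ⟨hv, hw⟩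
      simpa [hh, hv, hw, this] using dBin_tri _ _ _
    · have : v ∉ D := fun hc => hw ((hD v).1 hc).2
      simpa [hh, hv, hw, this] using dBin_tri _ _ _
  · have : v ∉ D := fun hc => hv ((hD v).1 hc).1
    simp [hv, this]

lemma sym2_map_inj (D : Finset ℕ) (f : ℕ → ℕ) (hi : ∀ v ∈ D, ∀ w ∈ D, f v = f w → v = w)
    (e e' : Sym2 ℕ) (he : ∀ v ∈ e, v ∈ D) (he' : ∀ v ∈ e', v ∈ D)
    (h : e.map f = e'.map f) : e = e' := by
  induction e using Sym2.ind with | _ a b =>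
  induction e' using Sym2.ind with | _ c d =>
  have ha := he a (by simp)
  have hb := he b (by simp)
  have hc := he' c (by simp)
  have hd := he' d (by simp)
  simp only [Sym2.map_mk, Sym2.eq_iff] at h ⊢
  rcases h with ⟨h1, h2⟩ | ⟨h1, h2⟩
  · exact Or.inl ⟨hi _ ha _ hc h1, hi _ hb _ hd h2⟩
  · exact Or.inr ⟨hi _ ha _ hd h1, hi _ hb _ hc h2⟩

lemma mem_matched {G₁ G₂ : LGraph α ε} (π : GMap G₁ G₂) (e : Sym2 ℕ) :
    e ∈ π.matchedEdges ↔ e ∈ G₁.E ∧ (∀ v ∈ e, v ∈ π.dom) ∧ e.map π.f ∈ G₂.E := by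
  simp [GMap.matchedEdges]

lemma cost_nonneg {G₁ G₂ : LGraph α ε} (π : GMap G₁ G₂) : 0 ≤ π.cost (dBin α) := by
  unfold GMap.cost
  have h : ∀ a b : α, 0 ≤ dBin α a b := dBin_nonneg
  have h' : ∀ {ι : Type} (s : Finset ι) (p q : ι → α), 0 ≤ ∑ v ∈ s, dBin α (p v) (q v) :=
    fun s p q => Finset.sum_nonneg fun _ _ => h _ _
  refine add_nonneg (add_nonneg (add_nonneg (add_nonneg (add_nonneg ?_ ?_) ?_) ?_) ?_) ?_ <;>
    exact Finset.sum_nonneg fun _ _ => h _ _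

lemma GED_le {G₁ G₂ : LGraph α ε} (π : GMap G₁ G₂) :
    GED (dBin α) G₁ G₂ ≤ π.cost (dBin α) := by
  refine csInf_le ⟨0, ?_⟩ ⟨π, rfl⟩
  rintro _ ⟨π, rfl⟩
  exact cost_nonneg π

lemma le_GED {G₁ G₂ : LGraph α ε} (c : ℝ) (h : ∀ π : GMap G₁ G₂, c ≤ π.cost (dBin α)) :
    c ≤ GED (dBin α) G₁ G₂ := by
  refine le_csInf ⟨_, ⟨⟨∅, by simp, id, by simp, by simp⟩, rfl⟩⟩ ?_
  rintro _ ⟨π, rfl⟩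
  exact h π

lemma SED_le {G₁ G₂ S : LGraph α ε} (hS : IsSubgraph S G₂) (π : GMap G₁ S) :
    SED (dBin α) G₁ G₂ ≤ π.cost (dBin α) := by
  refine le_trans (csInf_le ⟨0, ?_⟩ ⟨S, hS, rfl⟩) (GED_le π)
  rintro _ ⟨S, _, rfl⟩
  exact le_GED 0 fun π => cost_nonneg π

lemma le_SED {G₁ G₂ : LGraph α ε} (c : ℝ)
    (h : ∀ S : LGraph α ε, IsSubgraph S G₂ → ∀ π : GMap G₁ S, c ≤ π.cost (dBin α)) :
    c ≤ SED (dBin α) G₁ G₂ := by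
  refine le_csInf ⟨_, ⟨G₂, ⟨subset_rfl, subset_rfl, fun _ _ => rfl, fun _ _ => rfl⟩, rfl⟩⟩ ?_
  rintro _ ⟨S, hS, rfl⟩
  exact le_GED c (h S hS)

/-- The cost of a mapping into a subgraph is at least its deletion and relabelling part. -/
lemma half_le_cost {G₁ G₂ S : LGraph α ε} (hS : IsSubgraph S G₂) (π : GMap G₁ S) :
    (∑ v ∈ π.dom, dBin α (G₁.Lv v) (G₂.Lv (π.f v)) + ∑ v ∈ G₁.V \ π.dom, dBin α (G₁.Lv v) ε) +
    (∑ e ∈ π.matchedEdges, dBin α (G₁.Le e) (G₂.Le (e.map π.f)) +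
      ∑ e ∈ G₁.E \ π.matchedEdges, dBin α (G₁.Le e) ε) ≤ π.cost (dBin α) := by
  unfold GMap.cost
  have h1 : ∑ v ∈ π.dom, dBin α (G₁.Lv v) (S.Lv (π.f v)) =
      ∑ v ∈ π.dom, dBin α (G₁.Lv v) (G₂.Lv (π.f v)) :=
    Finset.sum_congr rfl fun v hv => by rw [hS.2.2.1 _ (π.maps_to v hv)]
  have h2 : ∑ e ∈ π.matchedEdges, dBin α (G₁.Le e) (S.Le (e.map π.f)) =
      ∑ e ∈ π.matchedEdges, dBin α (G₁.Le e) (G₂.Le (e.map π.f)) :=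
    Finset.sum_congr rfl fun e he => by rw [hS.2.2.2 _ ((mem_matched π e).1 he).2.2]
  have h3 : 0 ≤ ∑ w ∈ S.V \ π.dom.image π.f, dBin α ε (S.Lv w) :=
    Finset.sum_nonneg fun _ _ => dBin_nonneg _ _
  have h4 : 0 ≤ ∑ e ∈ S.E \ π.matchedEdges.image (Sym2.map π.f), dBin α ε (S.Le e) :=
    Finset.sum_nonneg fun _ _ => dBin_nonneg _ _
  rw [h1, h2]
  linarith

/-- The composite of two mappings into subgraphs. -/
lemma exists_comp {G₁ G₂ G₃ S T : LGraph α ε} (hS : IsSubgraph S G₂) (hT : IsSubgraph T G₃)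
    (π : GMap G₁ S) (ρ : GMap G₂ T) :
    ∃ (R : LGraph α ε) (_ : IsSubgraph R G₃) (σ : GMap G₁ R),
      σ.cost (dBin α) ≤ π.cost (dBin α) + ρ.cost (dBin α) := by
  let D := π.dom.filter fun v => π.f v ∈ ρ.dom
  let M := π.matchedEdges.filter fun e => e.map π.f ∈ ρ.matchedEdges
  let g : ℕ → ℕ := ρ.f ∘ π.f
  have hDm : ∀ v, v ∈ D ↔ v ∈ π.dom ∧ π.f v ∈ ρ.dom := fun v => Finset.mem_filter
  have hMm : ∀ e, e ∈ M ↔ e ∈ π.matchedEdges ∧ e.map π.f ∈ ρ.matchedEdges :=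
    fun e => Finset.mem_filter
  have hMD : ∀ e ∈ M, ∀ v ∈ e, v ∈ D := by
    intro e he v hv
    obtain ⟨h1, h2⟩ := (hMm e).1 he
    exact (hDm v).2 ⟨((mem_matched π e).1 h1).2.1 v hv,
      ((mem_matched ρ _).1 h2).2.1 _ (Sym2.mem_map.2 ⟨v, hv, rfl⟩)⟩
  have hgT : ∀ v ∈ D, g v ∈ T.V := fun v hv => ρ.maps_to _ ((hDm v).1 hv).2
  have hMT : ∀ e ∈ M, e.map g ∈ T.E := by
    intro e he
    have := ((mem_matched ρ _).1 ((hMm e).1 he).2).2.2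
    rwa [Sym2.map_map] at this
  have hVs : D.image g ⊆ T.V := by
    intro w hw
    obtain ⟨v, hv, rfl⟩ := Finset.mem_image.1 hw
    exact hgT v hv
  have hEs : M.image (Sym2.map g) ⊆ T.E := by
    intro w hw
    obtain ⟨v, hv, rfl⟩ := Finset.mem_image.1 hw
    exact hMT v hv
  have hginj : ∀ v ∈ D, ∀ w ∈ D, g v = g w → v = w := by
    intro v hv w hw h
    obtain ⟨a, b⟩ := (hDm v).1 hv
    obtain ⟨c, d⟩ := (hDm w).1 hw
    exact π.injOn v a w c (ρ.injOn _ b _ d h)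
  let R : LGraph α ε :=
    { V := D.image g
      E := M.image (Sym2.map g)
      edge_mem := by
        intro e he v hv
        obtain ⟨e', he', rfl⟩ := Finset.mem_image.1 he
        obtain ⟨u, hu, rfl⟩ := Sym2.mem_map.1 hv
        exact Finset.mem_image_of_mem _ (hMD e' he' u hu)
      Lv := G₃.Lv
      Le := G₃.Le
      Lv_ne := fun v hv => G₃.Lv_ne v (hT.1 (hVs hv))
      Le_ne := fun e he => G₃.Le_ne e (hT.2.1 (hEs he)) }
  have hR : IsSubgraph R G₃ :=
    ⟨fun v hv => hT.1 (hVs hv), fun e he => hT.2.1 (hEs he), fun _ _ => rfl, fun _ _ => rfl⟩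
  let σ : GMap G₁ R :=
    { dom := D
      dom_sub := fun v hv => π.dom_sub ((hDm v).1 hv).1
      f := g
      maps_to := fun v hv => Finset.mem_image_of_mem _ hv
      injOn := hginj }
  have hσM : σ.matchedEdges = M := by
    ext e
    rw [mem_matched]
    constructor
    · rintro ⟨_, h2, h3⟩
      obtain ⟨e', he', h⟩ := Finset.mem_image.1 h3
      have := sym2_map_inj D g hginj e' e (hMD e' he') h2 h
      exact this ▸ he'
    · intro he
      exact ⟨((mem_matched π e).1 ((hMm e).1 he).1).1, hMD e he, Finset.mem_image_of_mem _ he⟩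
  refine ⟨R, hR, σ, ?_⟩
  have key1 := half_le_cost hS π
  have key2 := half_le_cost hT ρ
  have bV := comp_bound ε G₁.V π.dom G₂.V ρ.dom D π.f ρ.f G₁.Lv G₂.Lv G₃.Lv π.dom_sub
    (fun v hv => hS.1 (π.maps_to v hv)) π.injOn ρ.dom_sub hDm
  have bE := comp_bound ε G₁.E π.matchedEdges G₂.E ρ.matchedEdges M (Sym2.map π.f) (Sym2.map ρ.f)
    G₁.Le G₂.Le G₃.Le (fun e he => ((mem_matched π e).1 he).1)
    (fun e he => hS.2.1 ((mem_matched π e).1 he).2.2)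
    (fun e he e' he' h => sym2_map_inj π.dom π.f π.injOn e e' ((mem_matched π e).1 he).2.1
      ((mem_matched π e').1 he').2.1 h)
    (fun e he => ((mem_matched ρ e).1 he).1) hMm
  have hc : σ.cost (dBin α) =
      (∑ v ∈ D, dBin α (G₁.Lv v) (G₃.Lv (ρ.f (π.f v))) + ∑ v ∈ G₁.V \ D, dBin α (G₁.Lv v) ε) +
      (∑ e ∈ M, dBin α (G₁.Le e) (G₃.Le ((e.map π.f).map ρ.f)) +
        ∑ e ∈ G₁.E \ M, dBin α (G₁.Le e) ε) := by
    unfold GMap.cost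
    rw [hσM]
    have z1 : R.V \ σ.dom.image σ.f = ∅ := Finset.sdiff_self _
    have z2 : R.E \ M.image (Sym2.map σ.f) = ∅ := Finset.sdiff_self _
    rw [z1, z2]
    simp only [Finset.sum_empty, add_zero, Sym2.map_map, add_assoc]
    rfl
  rw [hc]
  linarith

/-- Subgraph edit distance (with the binary label cost) satisfies the
triangle inequality: `SED(G₁,G₃) ≤ SED(G₁,G₂) + SED(G₂,G₃)`. -/
theorem sed_triangle_inequality {α : Type} {ε : α} (G₁ G₂ G₃ : LGraph α ε) :
    SED (dBin α) G₁ G₃ ≤ SED (dBin α) G₁ G₂ + SED (dBin α) G₂ G₃ := by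
  rw [← sub_le_iff_le_add]
  refine le_SED _ fun S hS π => ?_
  rw [sub_le_iff_le_add, ← sub_le_iff_le_add']
  refine le_SED _ fun T hT ρ => ?_
  rw [sub_le_iff_le_add']
  obtain ⟨R, hR, σ, h⟩ := exists_comp hS hT π ρ
  exact (SED_le hR σ).trans h
end

section
/- For all labelled graphs G₁ and G₂ (with the binary label cost d), the subgraph edit distance equals the graph edit distance computed with the modified cost that ignores insertions: SED(G₁, G₂) = ĜED(G₁, G₂). -/
open scoped BigOperators

variable {α : Type} {ε : α}

theorem aux_dBin_nonneg {α : Type} (a b : α) : 0 ≤ dBin α a b := by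
  unfold dBin; split_ifs <;> norm_num

theorem aux_dHat_nonneg {α : Type} (ε a b : α) : 0 ≤ dHat ε (dBin α) a b := by
  unfold dHat; split_ifs
  · exact le_rfl
  · exact aux_dBin_nonneg a b

theorem aux_cost_nonneg {α : Type} {ε : α} (d : α → α → ℝ) (hd : ∀ a b, 0 ≤ d a b)
    {G₁ G₂ : LGraph α ε} (π : GMap G₁ G₂) : 0 ≤ π.cost d := by
  unfold GMap.cost
  have h := fun (s : Finset ℕ) (f g : ℕ → α) =>
    Finset.sum_nonneg (s := s) (fun i _ => hd (f i) (g i))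
  have h' := fun (s : Finset (Sym2 ℕ)) (f g : Sym2 ℕ → α) =>
    Finset.sum_nonneg (s := s) (fun i _ => hd (f i) (g i))
  refine add_nonneg (add_nonneg (add_nonneg (add_nonneg (add_nonneg ?_ ?_) ?_) ?_) ?_) ?_
  · exact h _ _ _
  · exact h _ _ (fun _ => ε)
  · exact h _ (fun _ => ε) _
  · exact h' _ _ (fun e => G₂.Le (e.map π.f))
  · exact h' _ _ (fun _ => ε)
  · exact h' _ (fun _ => ε) _

theorem aux_GED_nonneg {α : Type} {ε : α} (d : α → α → ℝ) (hd : ∀ a b, 0 ≤ d a b)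
    (G₁ G₂ : LGraph α ε) : 0 ≤ GED d G₁ G₂ := by
  apply Real.sInf_nonneg
  rintro c ⟨π, rfl⟩
  exact aux_cost_nonneg d hd π

theorem aux_GED_le {α : Type} {ε : α} (d : α → α → ℝ) (hd : ∀ a b, 0 ≤ d a b)
    {G₁ G₂ : LGraph α ε} (π : GMap G₁ G₂) : GED d G₁ G₂ ≤ π.cost d := by
  refine csInf_le ⟨0, ?_⟩ ⟨π, rfl⟩
  rintro c ⟨π, rfl⟩
  exact aux_cost_nonneg d hd π

theorem aux_GED_set_nonempty {α : Type} {ε : α} (d : α → α → ℝ) (G₁ G₂ : LGraph α ε) :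
    { c | ∃ π : GMap G₁ G₂, c = π.cost d }.Nonempty :=
  ⟨_, ⟨∅, by simp, id, by simp, by simp⟩, rfl⟩

theorem aux_matched_sub {α : Type} {ε : α} {G₁ G₂ : LGraph α ε} (π : GMap G₁ G₂) :
    π.matchedEdges ⊆ G₁.E := by
  classical
  exact Finset.filter_subset _ _

open Classical in
/-- The modified cost of a mapping, in a form without insertions. -/
theorem aux_cost_hat {α : Type} {ε : α} {G₁ G₂ : LGraph α ε} (π : GMap G₁ G₂) :
    π.cost (dHat ε (dBin α)) =
      (∑ v ∈ π.dom, dBin α (G₁.Lv v) (G₂.Lv (π.f v)))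
      + (∑ v ∈ G₁.V \ π.dom, dBin α (G₁.Lv v) ε)
      + (∑ e ∈ π.matchedEdges, dBin α (G₁.Le e) (G₂.Le (e.map π.f)))
      + (∑ e ∈ G₁.E \ π.matchedEdges, dBin α (G₁.Le e) ε) := by
  have hv : ∀ v ∈ G₁.V, ∀ b, dHat ε (dBin α) (G₁.Lv v) b = dBin α (G₁.Lv v) b := by
    intro v hv b
    simp [dHat, G₁.Lv_ne v hv]
  have he : ∀ e ∈ G₁.E, ∀ b, dHat ε (dBin α) (G₁.Le e) b = dBin α (G₁.Le e) b := by
    intro v hv b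
    simp [dHat, G₁.Le_ne v hv]
  have h0 : ∀ b, dHat ε (dBin α) ε b = 0 := by intro b; simp [dHat]
  unfold GMap.cost
  simp only [h0, Finset.sum_const_zero, add_zero]
  rw [Finset.sum_congr rfl (fun v h => hv v (π.dom_sub h) _),
    Finset.sum_congr rfl (fun v h => hv v (Finset.mem_sdiff.1 h).1 _),
    Finset.sum_congr rfl (fun e h => he e (aux_matched_sub π h) _),
    Finset.sum_congr rfl (fun e h => he e (Finset.mem_sdiff.1 h).1 _)]

open Classical in
/-- Sums over matched and deleted edges, as one sum over all edges. -/
theorem aux_edge_sum {α : Type} {ε : α} {G₁ G₂ : LGraph α ε} (π : GMap G₁ G₂) :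
    (∑ e ∈ π.matchedEdges, dBin α (G₁.Le e) (G₂.Le (e.map π.f)))
      + (∑ e ∈ G₁.E \ π.matchedEdges, dBin α (G₁.Le e) ε) =
    ∑ e ∈ G₁.E, if e ∈ π.matchedEdges then dBin α (G₁.Le e) (G₂.Le (e.map π.f))
      else dBin α (G₁.Le e) ε := by
  rw [← Finset.sum_sdiff (aux_matched_sub π), add_comm]
  congr 1
  · exact Finset.sum_congr rfl (fun e h => by rw [if_neg (Finset.mem_sdiff.1 h).2])
  · exact Finset.sum_congr rfl (fun e h => by rw [if_pos h])

/-- A mapping into a subgraph, seen as a mapping into the whole graph. -/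
def auxLift {α : Type} {ε : α} {G₁ S G₂ : LGraph α ε} (h : IsSubgraph S G₂)
    (π : GMap G₁ S) : GMap G₁ G₂ :=
  ⟨π.dom, π.dom_sub, π.f, fun v hv => h.1 (π.maps_to v hv), π.injOn⟩

theorem aux_lift_cost {α : Type} {ε : α} {G₁ S G₂ : LGraph α ε} (h : IsSubgraph S G₂)
    (π : GMap G₁ S) : (auxLift h π).cost (dHat ε (dBin α)) ≤ π.cost (dBin α) := by
  classical
  have hle : π.cost (dHat ε (dBin α)) ≤ π.cost (dBin α) := by
    rw [aux_cost_hat]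
    unfold GMap.cost
    have h1 : 0 ≤ ∑ w ∈ S.V \ π.dom.image π.f, dBin α ε (S.Lv w) :=
      Finset.sum_nonneg fun _ _ => aux_dBin_nonneg _ _
    have h2 : 0 ≤ ∑ e ∈ S.E \ π.matchedEdges.image (Sym2.map π.f), dBin α ε (S.Le e) :=
      Finset.sum_nonneg fun _ _ => aux_dBin_nonneg _ _
    linarith
  refine le_trans ?_ hle
  rw [aux_cost_hat, aux_cost_hat, add_assoc, aux_edge_sum, add_assoc _ (∑ e ∈ π.matchedEdges, _),
    aux_edge_sum]
  refine add_le_add (add_le_add (le_of_eq ?_) le_rfl) (Finset.sum_le_sum ?_)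
  · refine Finset.sum_congr rfl fun v hv => ?_
    rw [h.2.2.1 _ (π.maps_to v hv)]
    rfl
  · intro e he
    by_cases hm : e ∈ π.matchedEdges
    · have hm2 := hm
      simp only [GMap.matchedEdges, Finset.mem_filter] at hm2
      have hm' : e ∈ (auxLift h π).matchedEdges := by
        simp only [GMap.matchedEdges, Finset.mem_filter]
        exact ⟨hm2.1, hm2.2.1, h.2.1 hm2.2.2⟩
      rw [if_pos hm, if_pos hm', h.2.2.2 _ hm2.2.2]
      exact le_rfl
    · rw [if_neg hm]
      have h1 : dBin α (G₁.Le e) ε = 1 := by simp [dBin, G₁.Le_ne e he]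
      rw [h1]
      unfold dBin
      split_ifs <;> norm_num

open Classical in
/-- The subgraph of `G₂` hit by a mapping. -/
noncomputable def auxImage {α : Type} {ε : α} {G₁ G₂ : LGraph α ε} (π : GMap G₁ G₂) :
    LGraph α ε where
  V := π.dom.image π.f
  E := π.matchedEdges.image (Sym2.map π.f)
  edge_mem := by
    intro e he v hv
    obtain ⟨e', he', rfl⟩ := Finset.mem_image.1 he
    obtain ⟨w, hw, rfl⟩ := Sym2.mem_map.1 hv
    simp only [GMap.matchedEdges, Finset.mem_filter] at he'
    exact Finset.mem_image_of_mem _ (he'.2.1 w hw)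
  Lv := G₂.Lv
  Le := G₂.Le
  Lv_ne := by
    intro v hv
    obtain ⟨w, hw, rfl⟩ := Finset.mem_image.1 hv
    exact G₂.Lv_ne _ (π.maps_to w hw)
  Le_ne := by
    intro e he
    obtain ⟨e', he', rfl⟩ := Finset.mem_image.1 he
    simp only [GMap.matchedEdges, Finset.mem_filter] at he'
    exact G₂.Le_ne _ he'.2.2

theorem aux_image_sub {α : Type} {ε : α} {G₁ G₂ : LGraph α ε} (π : GMap G₁ G₂) :
    IsSubgraph (auxImage π) G₂ := by
  classical
  refine ⟨?_, ?_, fun _ _ => rfl, fun _ _ => rfl⟩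
  · intro v hv
    obtain ⟨w, hw, rfl⟩ := Finset.mem_image.1 hv
    exact π.maps_to w hw
  · intro e he
    obtain ⟨e', he', rfl⟩ := Finset.mem_image.1 he
    simp only [GMap.matchedEdges, Finset.mem_filter] at he'
    exact he'.2.2

/-- A mapping, restricted to its image. -/
noncomputable def auxRestrict {α : Type} {ε : α} {G₁ G₂ : LGraph α ε} (π : GMap G₁ G₂) :
    GMap G₁ (auxImage π) :=
  ⟨π.dom, π.dom_sub, π.f, fun _ hv => Finset.mem_image_of_mem _ hv, π.injOn⟩

theorem aux_restrict_matched {α : Type} {ε : α} {G₁ G₂ : LGraph α ε} (π : GMap G₁ G₂) :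
    (auxRestrict π).matchedEdges = π.matchedEdges := by
  classical
  ext e
  constructor
  · intro h
    simp only [GMap.matchedEdges, Finset.mem_filter] at h ⊢
    exact ⟨h.1, h.2.1, (aux_image_sub π).2.1 h.2.2⟩
  · intro h
    have h2 : e.map π.f ∈ (auxImage π).E := Finset.mem_image_of_mem _ h
    simp only [GMap.matchedEdges, Finset.mem_filter] at h ⊢
    exact ⟨h.1, h.2.1, h2⟩

theorem aux_restrict_cost {α : Type} {ε : α} {G₁ G₂ : LGraph α ε} (π : GMap G₁ G₂) :
    (auxRestrict π).cost (dBin α) = π.cost (dHat ε (dBin α)) := by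
  classical
  rw [aux_cost_hat]
  unfold GMap.cost
  rw [aux_restrict_matched]
  have h1 : (auxImage π).V \ (auxRestrict π).dom.image (auxRestrict π).f = ∅ := by
    rw [Finset.sdiff_eq_empty_iff_subset]
    intro v hv
    simpa [auxImage, auxRestrict] using hv
  have h2 : (auxImage π).E \ π.matchedEdges.image (Sym2.map (auxRestrict π).f) = ∅ := by
    rw [Finset.sdiff_eq_empty_iff_subset]
    intro v hv
    simpa [auxImage, auxRestrict] using hv
  rw [h1, h2, Finset.sum_empty, Finset.sum_empty, add_zero, add_zero]
  rfl

/-- The subgraph edit distance (binary label cost) equals the graph edit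
distance computed with the modified cost ignoring insertions: `SED(G₁,G₂) = ĜED(G₁,G₂)`. -/
theorem sed_eq_ged_hat {α : Type} {ε : α} (G₁ G₂ : LGraph α ε) :
    SED (dBin α) G₁ G₂ = GED (dHat ε (dBin α)) G₁ G₂ := by
  apply le_antisymm
  · refine le_csInf (aux_GED_set_nonempty _ _ _) ?_
    rintro c ⟨π, rfl⟩
    rw [← aux_restrict_cost]
    refine le_trans (csInf_le ⟨0, ?_⟩ ⟨auxImage π, aux_image_sub π, rfl⟩)
      (aux_GED_le _ aux_dBin_nonneg _)
    rintro c ⟨S, -, rfl⟩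
    exact aux_GED_nonneg _ aux_dBin_nonneg _ _
  · refine le_csInf ⟨_, G₂, ⟨subset_rfl, subset_rfl, fun _ _ => rfl, fun _ _ => rfl⟩, rfl⟩ ?_
    rintro c ⟨S, hS, rfl⟩
    refine le_csInf (aux_GED_set_nonempty _ _ _) ?_
    rintro c ⟨π, rfl⟩
    exact le_trans (aux_GED_le _ (aux_dHat_nonneg ε) _) (aux_lift_cost hS π)
end

section
/- For all labelled graphs G₁ and G₂ (with the binary label cost d and the modified cost d̂ ignoring insertions), there exists a subgraph S of G₂ and a graph mapping π from G₁ to S such that GED_π(G₁, S) = ĜED(G₁, G₂). -/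
open scoped BigOperators

variable {α : Type} {ε : α}

theorem dHat_dBin_nat (ε a b : α) : ∃ n : ℕ, dHat ε (dBin α) a b = n := by
  unfold dHat dBin
  split_ifs
  · exact ⟨0, by simp⟩
  · exact ⟨0, by simp⟩
  · exact ⟨1, by simp⟩

theorem sum_nat_of_nat {ι : Type} (s : Finset ι) (g : ι → ℝ) (h : ∀ i, ∃ n : ℕ, g i = n) :
    ∃ n : ℕ, ∑ i ∈ s, g i = n := by
  choose k hk using h
  exact ⟨∑ i ∈ s, k i, by simp [hk]⟩

theorem cost_nat {G₁ G₂ : LGraph α ε} (π : GMap G₁ G₂) :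
    ∃ n : ℕ, π.cost (dHat ε (dBin α)) = n := by
  unfold GMap.cost
  obtain ⟨a, ha⟩ := sum_nat_of_nat π.dom _
    (fun v => dHat_dBin_nat ε (G₁.Lv v) (G₂.Lv (π.f v)))
  obtain ⟨b, hb⟩ := sum_nat_of_nat (G₁.V \ π.dom) _ (fun v => dHat_dBin_nat ε (G₁.Lv v) ε)
  obtain ⟨c, hc⟩ := sum_nat_of_nat (G₂.V \ π.dom.image π.f) _
    (fun v => dHat_dBin_nat ε ε (G₂.Lv v))
  obtain ⟨a', ha'⟩ := sum_nat_of_nat π.matchedEdges _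
    (fun e => dHat_dBin_nat ε (G₁.Le e) (G₂.Le (e.map π.f)))
  obtain ⟨b', hb'⟩ := sum_nat_of_nat (G₁.E \ π.matchedEdges) _
    (fun e => dHat_dBin_nat ε (G₁.Le e) ε)
  obtain ⟨c', hc'⟩ := sum_nat_of_nat (G₂.E \ π.matchedEdges.image (Sym2.map π.f)) _
    (fun v => dHat_dBin_nat ε ε (G₂.Le v))
  refine ⟨a + b + c + a' + b' + c', ?_⟩
  push_cast
  rw [← ha, ← hb, ← hc, ← ha', ← hb', ← hc']

theorem exists_optimal (G₁ G₂ : LGraph α ε) :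
    ∃ π : GMap G₁ G₂, π.cost (dHat ε (dBin α)) = GED (dHat ε (dBin α)) G₁ G₂ := by
  classical
  have hex : ∃ n : ℕ, ∃ π : GMap G₁ G₂, π.cost (dHat ε (dBin α)) = n := by
    let π : GMap G₁ G₂ := ⟨∅, by simp, id, by simp, by simp⟩
    obtain ⟨n, hn⟩ := cost_nat π
    exact ⟨n, π, hn⟩
  obtain ⟨π, hπ⟩ := Nat.find_spec hex
  refine ⟨π, ?_⟩
  have : IsLeast { c | ∃ π : GMap G₁ G₂, c = π.cost (dHat ε (dBin α)) }
      (π.cost (dHat ε (dBin α))) := by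
    refine ⟨⟨π, rfl⟩, ?_⟩
    rintro c ⟨π', rfl⟩
    obtain ⟨m, hm⟩ := cost_nat π'
    rw [hπ, hm]
    exact_mod_cast Nat.find_min' hex ⟨π', hm⟩
  exact this.csInf_eq.symm

open Classical in
/-- The subgraph of `G₂` hit by a mapping. -/
noncomputable def GMap.img {G₁ G₂ : LGraph α ε} (π : GMap G₁ G₂) : LGraph α ε where
  V := π.dom.image π.f
  E := π.matchedEdges.image (Sym2.map π.f)
  edge_mem := by
    intro e he v hv
    obtain ⟨e', he', rfl⟩ := Finset.mem_image.1 he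
    obtain ⟨w, hw, rfl⟩ := Sym2.mem_map.1 hv
    exact Finset.mem_image_of_mem _ ((Finset.mem_filter.1 he').2.1 w hw)
  Lv := G₂.Lv
  Le := G₂.Le
  Lv_ne := by
    intro v hv
    obtain ⟨w, hw, rfl⟩ := Finset.mem_image.1 hv
    exact G₂.Lv_ne _ (π.maps_to w hw)
  Le_ne := by
    intro e he
    obtain ⟨e', he', rfl⟩ := Finset.mem_image.1 he
    exact G₂.Le_ne _ (Finset.mem_filter.1 he').2.2

/-- The mapping onto the hit subgraph. -/
noncomputable def GMap.toImg {G₁ G₂ : LGraph α ε} (π : GMap G₁ G₂) : GMap G₁ π.img where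
  dom := π.dom
  dom_sub := π.dom_sub
  f := π.f
  maps_to := fun _ hv => Finset.mem_image_of_mem _ hv
  injOn := π.injOn

theorem matchedEdges_toImg {G₁ G₂ : LGraph α ε} (π : GMap G₁ G₂) :
    π.toImg.matchedEdges = π.matchedEdges := by
  classical
  ext e
  constructor
  · intro h
    obtain ⟨h1, h2, h3⟩ := Finset.mem_filter.1 h
    obtain ⟨e', he', h4⟩ := Finset.mem_image.1 h3
    refine Finset.mem_filter.2 ⟨h1, h2, ?_⟩
    have := (Finset.mem_filter.1 he').2.2
    rw [h4] at this
    exact this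
  · intro h
    obtain ⟨h1, h2, h3⟩ := Finset.mem_filter.1 h
    exact Finset.mem_filter.2 ⟨h1, h2, Finset.mem_image.2 ⟨e, h, rfl⟩⟩

theorem dHat_of_ne {a : α} (h : a ≠ ε) (d : α → α → ℝ) (b : α) : dHat ε d a b = d a b := by
  simp [dHat, h]

theorem cost_toImg {G₁ G₂ : LGraph α ε} (π : GMap G₁ G₂) :
    π.toImg.cost (dBin α) = π.cost (dHat ε (dBin α)) := by
  classical
  unfold GMap.cost
  rw [matchedEdges_toImg]
  have hsub : π.matchedEdges ⊆ G₁.E := Finset.filter_subset _ _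
  congr 1; congr 1; congr 1; congr 1; congr 1
  · exact Finset.sum_congr rfl fun v hv => (dHat_of_ne (G₁.Lv_ne v (π.dom_sub hv)) _ _).symm
  · exact Finset.sum_congr rfl fun v hv =>
      (dHat_of_ne (G₁.Lv_ne v (Finset.mem_sdiff.1 hv).1) _ _).symm
  · simp [dHat, GMap.img, GMap.toImg]
  · exact Finset.sum_congr rfl fun v hv => (dHat_of_ne (G₁.Le_ne v (hsub hv)) _ _).symm
  · exact Finset.sum_congr rfl fun v hv =>
      (dHat_of_ne (G₁.Le_ne v (Finset.mem_sdiff.1 hv).1) _ _).symm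
  · simp [dHat, GMap.img, GMap.toImg]

/-- There exists a subgraph `S` of `G₂` and a graph mapping `π` from `G₁`
to `S` such that `GED_π(G₁, S) = ĜED(G₁, G₂)` (with the binary label cost `d` and the
modified cost `d̂` ignoring insertions). -/
theorem exists_subgraph_map_cost_eq_ged_hat {α : Type} {ε : α} (G₁ G₂ : LGraph α ε) :
    ∃ S : LGraph α ε, IsSubgraph S G₂ ∧
      ∃ π : GMap G₁ S, π.cost (dBin α) = GED (dHat ε (dBin α)) G₁ G₂ := by
  classical
  obtain ⟨π, hπ⟩ := exists_optimal G₁ G₂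
  refine ⟨π.img, ⟨?_, ?_, fun _ _ => rfl, fun _ _ => rfl⟩, π.toImg, (cost_toImg π).trans hπ⟩
  · intro v hv
    obtain ⟨w, hw, rfl⟩ := Finset.mem_image.1 hv
    exact π.maps_to w hw
  · intro e he
    obtain ⟨e', he', rfl⟩ := Finset.mem_image.1 he
    exact (Finset.mem_filter.1 he').2.2
end

section
/- Let S be a closest subgraph to G₁ in G₂ (i.e. S ⊆ G₂ and SED(G₁, G₂) = GED(G₁, S)), and let S′ be a subgraph of G₂ that contains S as a subgraph (S ⊆ S′ ⊆ G₂). Then S is also a closest subgraph to G₁ in S′, and SED(G₁, S′) = SED(G₁, G₂). -/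
open scoped BigOperators

variable {α : Type} {ε : α}

/-- If `S` is a closest subgraph to `G₁` in `G₂` and `S ⊆ S′ ⊆ G₂`, then
`S` is also a closest subgraph to `G₁` in `S′`, and `SED(G₁, S′) = SED(G₁, G₂)`
(binary label cost). -/
theorem closest_subgraph_of_intermediate {α : Type} {ε : α}
    (G₁ G₂ S S' : LGraph α ε)
    (hS : IsSubgraph S G₂) (hclosest : SED (dBin α) G₁ G₂ = GED (dBin α) G₁ S)
    (hSS' : IsSubgraph S S') (hS'G₂ : IsSubgraph S' G₂) :
    SED (dBin α) G₁ S' = GED (dBin α) G₁ S ∧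
      SED (dBin α) G₁ S' = SED (dBin α) G₁ G₂ := by
  have hd : ∀ a b : α, 0 ≤ dBin α a b := by
    intro a b
    unfold dBin
    split_ifs <;> norm_num
  have hcost : ∀ (H : LGraph α ε) (π : GMap G₁ H), 0 ≤ π.cost (dBin α) := by
    intro H π
    unfold GMap.cost
    have h (s : Finset ℕ) (u v : ℕ → α) : 0 ≤ ∑ x ∈ s, dBin α (u x) (v x) :=
      Finset.sum_nonneg fun _ _ => hd _ _
    have h2 (s : Finset (Sym2 ℕ)) (u v : Sym2 ℕ → α) : 0 ≤ ∑ x ∈ s, dBin α (u x) (v x) :=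
      Finset.sum_nonneg fun _ _ => hd _ _
    exact add_nonneg (add_nonneg (add_nonneg (add_nonneg (add_nonneg
      (h _ _ _) (h _ _ _)) (h _ _ _)) (h2 _ _ _)) (h2 _ _ _)) (h2 _ _ _)
  have hGED : ∀ H : LGraph α ε, 0 ≤ GED (dBin α) G₁ H := by
    intro H
    apply Real.sInf_nonneg
    rintro c ⟨π, rfl⟩
    exact hcost H π
  have hbdd : ∀ H : LGraph α ε,
      BddBelow { c | ∃ T : LGraph α ε, IsSubgraph T H ∧ c = GED (dBin α) G₁ T } := by
    intro H
    refine ⟨0, ?_⟩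
    rintro c ⟨T, _, rfl⟩
    exact hGED T
  have htrans : ∀ T : LGraph α ε, IsSubgraph T S' → IsSubgraph T G₂ := by
    rintro T ⟨h1, h2, h3, h4⟩
    obtain ⟨k1, k2, k3, k4⟩ := hS'G₂
    exact ⟨h1.trans k1, h2.trans k2, fun v hv => (h3 v hv).trans (k3 v (h1 hv)),
      fun e he => (h4 e he).trans (k4 e (h2 he))⟩
  have hle : SED (dBin α) G₁ S' ≤ GED (dBin α) G₁ S :=
    csInf_le (hbdd S') ⟨S, hSS', rfl⟩
  have hge : SED (dBin α) G₁ G₂ ≤ SED (dBin α) G₁ S' := by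
    refine csInf_le_csInf (hbdd G₂) ⟨GED (dBin α) G₁ S, S, hSS', rfl⟩ ?_
    rintro c ⟨T, hT, rfl⟩
    exact ⟨T, htrans T hT, rfl⟩
  have heq : SED (dBin α) G₁ S' = GED (dBin α) G₁ S := le_antisymm hle (hclosest ▸ hge)
  exact ⟨heq, heq.trans hclosest.symm⟩
end

section
/- If the label cost d is a metric on Σ, then GED is a metric on labelled graphs (up to isomorphism): GED(G₁,G₂) ≥ 0; GED(G₁,G₂) = 0 if and only if G₁ is isomorphic to G₂; GED(G₁,G₂) = GED(G₂,G₁); and GED(G₁,G₃) ≤ GED(G₁,G₂) + GED(G₂,G₃). In particular this holds for the binary cost. -/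
open scoped BigOperators

variable {α : Type} {ε : α}

/-- `G₁` is isomorphic to `G₂`: there is a bijection between their node sets preserving
node labels, edges, and edge labels. -/
def Isomorphic {α : Type} {ε : α} (G₁ G₂ : LGraph α ε) : Prop :=
  ∃ g : ℕ → ℕ, Set.InjOn g ↑G₁.V ∧ G₁.V.image g = G₂.V ∧
    (∀ v ∈ G₁.V, G₂.Lv (g v) = G₁.Lv v) ∧
    G₁.E.image (Sym2.map g) = G₂.E ∧ (∀ e ∈ G₁.E, G₂.Le (e.map g) = G₁.Le e)

namespace GEDProof

/-- Cost of a partial matching `M`, written as total deletion and insertion cost minus savings. -/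
noncomputable def relCost {α ι κ : Type} (ε : α) (d : α → α → ℝ) (A : Finset ι) (B : Finset κ)
    (la : ι → α) (lb : κ → α) (M : Finset (ι × κ)) : ℝ :=
  ∑ a ∈ A, d (la a) ε + ∑ b ∈ B, d ε (lb b)
    - ∑ m ∈ M, (d (la m.1) ε + d ε (lb m.2) - d (la m.1) (lb m.2))

/-- `M` is a partial injective matching. -/
def PInj {ι κ : Type} (M : Finset (ι × κ)) : Prop :=
  (∀ m ∈ M, ∀ n ∈ M, m.1 = n.1 → m = n) ∧ (∀ m ∈ M, ∀ n ∈ M, m.2 = n.2 → m = n)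

theorem relCost_bridge {α ι κ : Type} [DecidableEq ι] [DecidableEq κ] (ε : α) (d : α → α → ℝ)
    (A : Finset ι) (B : Finset κ) (la : ι → α) (lb : κ → α) (S : Finset ι) (g : ι → κ)
    (hS : S ⊆ A) (hg : ∀ s ∈ S, g s ∈ B) (hinj : Set.InjOn g S) (M : Finset (ι × κ))
    (hM : M = S.image (fun a => (a, g a))) :
    (∑ v ∈ S, d (la v) (lb (g v))) + (∑ v ∈ A \ S, d (la v) ε)
      + (∑ w ∈ B \ S.image g, d ε (lb w)) = relCost ε d A B la lb M := by
  subst hM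
  unfold relCost
  rw [Finset.sum_image (by intro x _ y _ h; exact congrArg Prod.fst h)]
  have h1 := Finset.sum_sdiff (f := fun v => d (la v) ε) hS
  have h2 := Finset.sum_sdiff (f := fun v => d ε (lb v)) (Finset.image_subset_iff.2 hg)
  rw [Finset.sum_image hinj] at h2
  rw [← h1, ← h2]
  simp only [Finset.sum_sub_distrib, Finset.sum_add_distrib]
  ring

theorem relCost_triangle {α ι κ μ : Type} (ε : α) (d : α → α → ℝ)
    (hnonneg : ∀ a b, 0 ≤ d a b)
    (hsymm : ∀ a b, d a b = d b a) (htri : ∀ a b c, d a c ≤ d a b + d b c)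
    (A : Finset ι) (B : Finset κ) (C : Finset μ) (la : ι → α) (lb : κ → α) (lc : μ → α)
    (M : Finset (ι × κ)) (N : Finset (κ × μ)) (P : Finset (ι × μ))
    (hM : PInj M) (hN : PInj N) (hMB : ∀ m ∈ M, m.2 ∈ B) (hNB : ∀ n ∈ N, n.1 ∈ B)
    (hP : ∀ m ∈ M, ∀ n ∈ N, m.2 = n.1 → (m.1, n.2) ∈ P) :
    relCost ε d A C la lc P ≤ relCost ε d A B la lb M + relCost ε d B C lb lc N := by
  classical
  unfold relCost
  set w := fun p : ι × μ => d (la p.1) ε + d ε (lc p.2) - d (la p.1) (lc p.2) with hw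
  have hw0 : ∀ p, 0 ≤ w p := fun p => by have := htri (la p.1) ε (lc p.2); simp only [hw]; linarith
  have e1 := Finset.sum_fiberwise_of_maps_to (s := M) (t := B) (g := Prod.snd) hMB
    (fun m => d (la m.1) ε + d ε (lb m.2) - d (la m.1) (lb m.2))
  have e2 := Finset.sum_fiberwise_of_maps_to (s := N) (t := B) (g := Prod.fst) hNB
    (fun m => d (lb m.1) ε + d ε (lc m.2) - d (lb m.1) (lc m.2))
  have e3 : ∑ b ∈ B, ∑ q ∈ (M.filter (fun m => m.2 = b)) ×ˢ (N.filter (fun n => n.1 = b)),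
      w (q.1.1, q.2.2) ≤ ∑ p ∈ P, w p := by
    rw [Finset.sum_sigma', ← Finset.sum_image (f := w) 
      (g := fun x : (_ : κ) × ((ι × κ) × (κ × μ)) => (x.2.1.1, x.2.2.2))]
    · apply Finset.sum_le_sum_of_subset_of_nonneg
      · intro p hp
        simp only [Finset.mem_image, Finset.mem_sigma, Finset.mem_product, Finset.mem_filter] at hp
        obtain ⟨⟨b, m, n⟩, ⟨_, ⟨h1, h2⟩, h3, h4⟩, rfl⟩ := hp
        exact hP m h1 n h3 (h2.trans h4.symm)
      · intro p _ _; exact hw0 p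
    · rintro ⟨b, m, n⟩ h ⟨b', m', n'⟩ h' heq
      simp only [Finset.coe_sigma, Set.mem_sigma_iff, Finset.mem_coe, Finset.mem_product,
        Finset.mem_filter] at h h'
      obtain ⟨_, ⟨h1, h2⟩, h3, h4⟩ := h
      obtain ⟨_, ⟨h1', h2'⟩, h3', h4'⟩ := h'
      simp only [Prod.mk.injEq] at heq
      have hm := hM.1 m h1 m' h1' heq.1
      subst hm
      have hn := hN.2 n h3 n' h3' heq.2
      subst hn
      have hb : b = b' := h2.symm.trans h2'
      subst hb
      rfl
  have key : ∀ b ∈ B,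
      (∑ m ∈ M with m.2 = b, (d (la m.1) ε + d ε (lb m.2) - d (la m.1) (lb m.2)))
      + (∑ m ∈ N with m.1 = b, (d (lb m.1) ε + d ε (lc m.2) - d (lb m.1) (lc m.2)))
      ≤ (d ε (lb b) + d (lb b) ε) +
      ∑ q ∈ (M.filter (fun m => m.2 = b)) ×ˢ (N.filter (fun n => n.1 = b)), w (q.1.1, q.2.2) := by
    intro b _
    have c1 : (M.filter (fun m => m.2 = b)).card ≤ 1 := by
      rw [Finset.card_le_one]
      intro x hx y hy
      simp only [Finset.mem_filter] at hx hy
      exact hM.2 x hx.1 y hy.1 (hx.2.trans hy.2.symm)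
    have c2 : (N.filter (fun m => m.1 = b)).card ≤ 1 := by
      rw [Finset.card_le_one]
      intro x hx y hy
      simp only [Finset.mem_filter] at hx hy
      exact hN.1 x hx.1 y hy.1 (hx.2.trans hy.2.symm)
    have f1 : ∀ x ∈ M.filter (fun m => m.2 = b), x.2 = b := fun x hx => (Finset.mem_filter.1 hx).2
    have f2 : ∀ x ∈ N.filter (fun m => m.1 = b), x.1 = b := fun x hx => (Finset.mem_filter.1 hx).2
    generalize M.filter (fun m => m.2 = b) = X at *
    generalize N.filter (fun m => m.1 = b) = Y at *
    have n1 := hnonneg ε (lb b)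
    have s1 := hsymm ε (lb b)
    rcases Nat.le_one_iff_eq_zero_or_eq_one.1 c1 with h1 | h1 <;>
    rcases Nat.le_one_iff_eq_zero_or_eq_one.1 c2 with h2 | h2
    · rw [Finset.card_eq_zero] at h1 h2
      subst h1 h2
      simp; linarith
    · rw [Finset.card_eq_zero] at h1
      obtain ⟨y, rfl⟩ := Finset.card_eq_one.1 h2
      subst h1
      have := f2 y (by simp)
      simp [this]
      have := htri ε (lb b) (lc y.2)
      linarith
    · rw [Finset.card_eq_zero] at h2
      obtain ⟨x, rfl⟩ := Finset.card_eq_one.1 h1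
      subst h2
      have := f1 x (by simp)
      simp [this]
      have := htri (la x.1) (lb b) ε
      linarith
    · obtain ⟨x, rfl⟩ := Finset.card_eq_one.1 h1
      obtain ⟨y, rfl⟩ := Finset.card_eq_one.1 h2
      have g1 := f1 x (by simp)
      have g2 := f2 y (by simp)
      simp [g1, g2, hw]
      have := htri (la x.1) (lb b) (lc y.2)
      linarith
  have := Finset.sum_le_sum key
  simp only [Finset.sum_add_distrib] at this
  rw [e1, e2] at this
  linarith

theorem relCost_swap {α ι κ : Type} [DecidableEq ι] [DecidableEq κ] (ε : α) (d : α → α → ℝ)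
    (hsymm : ∀ a b, d a b = d b a)
    (A : Finset ι) (B : Finset κ) (la : ι → α) (lb : κ → α) (M : Finset (ι × κ))
    (N : Finset (κ × ι)) (hN : ∀ p, p ∈ N ↔ p.swap ∈ M) :
    relCost ε d A B la lb M = relCost ε d B A lb la N := by
  have : N = M.image Prod.swap := by
    ext ⟨a, b⟩; simp [hN]
  subst this
  unfold relCost
  rw [Finset.sum_image (Prod.swap_injective.injOn)]
  simp only [Prod.fst_swap, Prod.snd_swap]
  simp only [hsymm ε]
  have : ∀ x y, d (lb x) (la y) = d (la y) (lb x) := fun x y => hsymm _ _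
  simp only [this]
  rw [add_comm (∑ a ∈ A, _)]
  congr 1
  exact Finset.sum_congr rfl fun m _ => by ring



open Classical in
/-- Edge matching induced by a node matching. -/
noncomputable def edgeRel (G₁ G₂ : LGraph α ε) (M : Finset (ℕ × ℕ)) :
    Finset (Sym2 ℕ × Sym2 ℕ) :=
  (G₁.E ×ˢ G₂.E).filter fun p => ∃ m ∈ M, ∃ n ∈ M, p.1 = s(m.1, n.1) ∧ p.2 = s(m.2, n.2)

/-- Total cost of a node matching. -/
noncomputable def totCost (d : α → α → ℝ) (G₁ G₂ : LGraph α ε) (M : Finset (ℕ × ℕ)) : ℝ :=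
  relCost ε d G₁.V G₂.V G₁.Lv G₂.Lv M + relCost ε d G₁.E G₂.E G₁.Le G₂.Le (edgeRel G₁ G₂ M)

/-- Node matchings between two graphs. -/
def IsMatch (G₁ G₂ : LGraph α ε) (M : Finset (ℕ × ℕ)) : Prop :=
  M ⊆ G₁.V ×ˢ G₂.V ∧ PInj M

theorem mem_edgeRel (G₁ G₂ : LGraph α ε) (M : Finset (ℕ × ℕ)) (p : Sym2 ℕ × Sym2 ℕ) :
    p ∈ edgeRel G₁ G₂ M ↔ (p.1 ∈ G₁.E ∧ p.2 ∈ G₂.E) ∧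
      ∃ m ∈ M, ∃ n ∈ M, p.1 = s(m.1, n.1) ∧ p.2 = s(m.2, n.2) := by
  simp only [edgeRel, Finset.mem_filter, Finset.mem_product]

theorem edgeRel_pinj (G₁ G₂ : LGraph α ε) (M : Finset (ℕ × ℕ)) (hM : PInj M) :
    PInj (edgeRel G₁ G₂ M) := by
  constructor
  · rintro ⟨p1, p2⟩ hp ⟨q1, q2⟩ hq h
    rw [mem_edgeRel] at hp hq
    obtain ⟨_, m, hm, n, hn, h1, h2⟩ := hp
    obtain ⟨_, m', hm', n', hn', h1', h2'⟩ := hq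
    simp only at h1 h2 h1' h2' h
    subst h1 h2 h1' h2'
    rw [Sym2.eq_iff] at h
    rcases h with ⟨a, b⟩ | ⟨a, b⟩
    · rw [hM.1 m hm m' hm' a, hM.1 n hn n' hn' b]
    · rw [hM.1 m hm n' hn' a, hM.1 n hn m' hm' b, Sym2.eq_swap (a := n'.1), Sym2.eq_swap (a := n'.2)]
  · rintro ⟨p1, p2⟩ hp ⟨q1, q2⟩ hq h
    rw [mem_edgeRel] at hp hq
    obtain ⟨_, m, hm, n, hn, h1, h2⟩ := hp
    obtain ⟨_, m', hm', n', hn', h1', h2'⟩ := hq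
    simp only at h1 h2 h1' h2' h
    subst h1 h2 h1' h2'
    rw [Sym2.eq_iff] at h
    rcases h with ⟨a, b⟩ | ⟨a, b⟩
    · rw [hM.2 m hm m' hm' a, hM.2 n hn n' hn' b]
    · rw [hM.2 m hm n' hn' a, hM.2 n hn m' hm' b, Sym2.eq_swap (a := n'.1), Sym2.eq_swap (a := n'.2)]

theorem edgeRel_gmap {G₁ G₂ : LGraph α ε} (π : GMap G₁ G₂) (p : Sym2 ℕ × Sym2 ℕ) :
    p ∈ edgeRel G₁ G₂ (π.dom.image fun v => (v, π.f v)) ↔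
      p.1 ∈ π.matchedEdges ∧ p.2 = p.1.map π.f := by
  rw [mem_edgeRel]
  simp only [GMap.matchedEdges, Finset.mem_filter]
  obtain ⟨e, e'⟩ := p
  constructor
  · rintro ⟨⟨h1, h2⟩, m, hm, n, hn, h3, h4⟩
    simp only [Finset.mem_image] at hm hn
    obtain ⟨v, hv, rfl⟩ := hm
    obtain ⟨w, hw, rfl⟩ := hn
    simp only at h1 h2 h3 h4
    subst h3 h4
    refine ⟨⟨h1, ?_, by simpa using h2⟩, by simp⟩
    intro u hu
    rcases Sym2.mem_iff.1 hu with rfl | rfl <;> assumption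
  · rintro ⟨⟨h1, h2, h3⟩, h4⟩
    simp only at h1 h2 h3 h4
    subst h4
    induction e with
    | _ v w =>
    exact ⟨⟨h1, h3⟩, (v, π.f v), Finset.mem_image_of_mem _ (h2 v (by simp)),
      (w, π.f w), Finset.mem_image_of_mem _ (h2 w (by simp)), rfl, by simp⟩

theorem gmap_isMatch {G₁ G₂ : LGraph α ε} (π : GMap G₁ G₂) :
    IsMatch G₁ G₂ (π.dom.image fun v => (v, π.f v)) := by
  refine ⟨?_, ?_, ?_⟩
  · intro p hp
    obtain ⟨v, hv, rfl⟩ := Finset.mem_image.1 hp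
    exact Finset.mem_product.2 ⟨π.dom_sub hv, π.maps_to v hv⟩
  · intro p hp q hq h
    obtain ⟨v, hv, rfl⟩ := Finset.mem_image.1 hp
    obtain ⟨w, hw, rfl⟩ := Finset.mem_image.1 hq
    simp only at h; rw [h]
  · intro p hp q hq h
    obtain ⟨v, hv, rfl⟩ := Finset.mem_image.1 hp
    obtain ⟨w, hw, rfl⟩ := Finset.mem_image.1 hq
    rw [π.injOn v hv w hw h]

theorem gmap_cost (d : α → α → ℝ) {G₁ G₂ : LGraph α ε} (π : GMap G₁ G₂) :
    π.cost d = totCost d G₁ G₂ (π.dom.image fun v => (v, π.f v)) := by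
  classical
  have hE : edgeRel G₁ G₂ (π.dom.image fun v => (v, π.f v)) =
      π.matchedEdges.image (fun e => (e, e.map π.f)) := by
    ext ⟨e, e'⟩
    rw [edgeRel_gmap]
    simp only [Finset.mem_image, Prod.mk.injEq]
    constructor
    · rintro ⟨h, rfl⟩; exact ⟨e, h, rfl, rfl⟩
    · rintro ⟨_, h, rfl, rfl⟩; exact ⟨h, rfl⟩
  have hinj : Set.InjOn (Sym2.map π.f) (π.matchedEdges : Set (Sym2 ℕ)) := by
    intro e he e' he' h
    have a := (edgeRel_gmap π (e, e.map π.f)).2 ⟨he, rfl⟩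
    have b := (edgeRel_gmap π (e', e'.map π.f)).2 ⟨he', rfl⟩
    exact congrArg Prod.fst ((edgeRel_pinj G₁ G₂ _ (gmap_isMatch π).2).2 _ a _ b h)
  have b1 := relCost_bridge ε d G₁.V G₂.V G₁.Lv G₂.Lv π.dom π.f π.dom_sub π.maps_to
    (fun a ha b hb h => π.injOn a ha b hb h) _ rfl
  have b2 := relCost_bridge ε d G₁.E G₂.E G₁.Le G₂.Le π.matchedEdges (Sym2.map π.f)
    (Finset.filter_subset _ _) (fun e he => (Finset.mem_filter.1 he).2.2) hinj _ hE
  have hc : π.cost d = ((∑ v ∈ π.dom, d (G₁.Lv v) (G₂.Lv (π.f v)))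
      + (∑ v ∈ G₁.V \ π.dom, d (G₁.Lv v) ε)
      + (∑ w ∈ G₂.V \ π.dom.image π.f, d ε (G₂.Lv w)))
      + ((∑ e ∈ π.matchedEdges, d (G₁.Le e) (G₂.Le (e.map π.f)))
      + (∑ e ∈ G₁.E \ π.matchedEdges, d (G₁.Le e) ε)
      + (∑ e ∈ G₂.E \ π.matchedEdges.image (Sym2.map π.f), d ε (G₂.Le e))) := by
    have : ∀ a b c x y z : ℝ, a + b + c + (x + y + z) = a + b + c + x + y + z := by
      intros; ring
    rw [this]
    unfold GMap.cost
    congr!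
  rw [hc, totCost]
  refine congrArg₂ (· + ·) ?_ ?_
  · convert b1
  · convert b2

theorem exists_gmap {G₁ G₂ : LGraph α ε} (M : Finset (ℕ × ℕ)) (hM : IsMatch G₁ G₂ M) :
    ∃ π : GMap G₁ G₂, (π.dom.image fun v => (v, π.f v)) = M := by
  classical
  obtain ⟨hs, h1, h2⟩ := hM
  have hex : ∀ v, ∃ w, (∃ w', (v, w') ∈ M) → (v, w) ∈ M := by
    intro v
    by_cases h : ∃ w', (v, w') ∈ M
    · exact ⟨h.choose, fun _ => h.choose_spec⟩
    · exact ⟨0, fun h' => (h h').elim⟩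
  choose f hf using hex
  have hfm : ∀ v ∈ M.image Prod.fst, (v, f v) ∈ M := by
    intro v hv
    obtain ⟨⟨a, b⟩, hp, rfl⟩ := Finset.mem_image.1 hv
    exact hf a ⟨b, hp⟩
  refine ⟨⟨M.image Prod.fst, ?_, f, ?_, ?_⟩, ?_⟩
  · intro v hv
    exact (Finset.mem_product.1 (hs (hfm v hv))).1
  · intro v hv
    exact (Finset.mem_product.1 (hs (hfm v hv))).2
  · intro v hv w hw h
    exact congrArg Prod.fst (h2 _ (hfm v hv) _ (hfm w hw) h)
  · ext ⟨a, b⟩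
    constructor
    · intro h
      obtain ⟨v, hv, h⟩ := Finset.mem_image.1 h
      rw [← h]; exact hfm v hv
    · intro h
      refine Finset.mem_image.2 ⟨a, Finset.mem_image.2 ⟨(a, b), h, rfl⟩, ?_⟩
      exact h1 _ (hf a ⟨b, h⟩) _ h rfl

theorem cost_set_eq (d : α → α → ℝ) (G₁ G₂ : LGraph α ε) :
    { c | ∃ π : GMap G₁ G₂, c = π.cost d } =
      (totCost d G₁ G₂) '' { M | IsMatch G₁ G₂ M } := by
  ext c
  constructor
  · rintro ⟨π, rfl⟩
    exact ⟨_, gmap_isMatch π, (gmap_cost d π).symm⟩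
  · rintro ⟨M, hM, rfl⟩
    obtain ⟨π, hπ⟩ := exists_gmap M hM
    exact ⟨π, by rw [gmap_cost, hπ]⟩

theorem cost_set_finite (d : α → α → ℝ) (G₁ G₂ : LGraph α ε) :
    { c | ∃ π : GMap G₁ G₂, c = π.cost d }.Finite := by
  rw [cost_set_eq]
  apply Set.Finite.image
  apply Set.Finite.subset (Finset.finite_toSet (G₁.V ×ˢ G₂.V).powerset)
  intro M hM
  exact Finset.mem_coe.2 (Finset.mem_powerset.2 hM.1)

theorem ged_attained (d : α → α → ℝ) (G₁ G₂ : LGraph α ε) :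
    ∃ π : GMap G₁ G₂, GED d G₁ G₂ = π.cost d := by
  have hne : { c | ∃ π : GMap G₁ G₂, c = π.cost d }.Nonempty :=
    ⟨_, ⟨∅, by simp, id, by simp, by simp⟩, rfl⟩
  exact hne.csInf_mem (cost_set_finite d G₁ G₂)

theorem ged_le (d : α → α → ℝ) {G₁ G₂ : LGraph α ε} (M : Finset (ℕ × ℕ))
    (hM : IsMatch G₁ G₂ M) : GED d G₁ G₂ ≤ totCost d G₁ G₂ M := by
  apply csInf_le (cost_set_finite d G₁ G₂).bddBelow
  rw [cost_set_eq]
  exact ⟨M, hM, rfl⟩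

theorem ged_attained' (d : α → α → ℝ) (G₁ G₂ : LGraph α ε) :
    ∃ M, IsMatch G₁ G₂ M ∧ GED d G₁ G₂ = totCost d G₁ G₂ M := by
  obtain ⟨π, h⟩ := ged_attained d G₁ G₂
  exact ⟨_, gmap_isMatch π, h.trans (gmap_cost d π)⟩

theorem cost_nonneg (d : α → α → ℝ) (hnonneg : ∀ a b, 0 ≤ d a b) {G₁ G₂ : LGraph α ε}
    (π : GMap G₁ G₂) : 0 ≤ π.cost d := by
  unfold GMap.cost
  have := fun (ι : Type) (s : Finset ι) (f g : ι → α) =>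
    Finset.sum_nonneg (s := s) (fun i _ => hnonneg (f i) (g i))
  repeat' apply add_nonneg
  all_goals exact Finset.sum_nonneg fun i _ => hnonneg _ _

theorem ged_nonneg (d : α → α → ℝ) (hnonneg : ∀ a b, 0 ≤ d a b) (G₁ G₂ : LGraph α ε) :
    0 ≤ GED d G₁ G₂ := by
  obtain ⟨π, h⟩ := ged_attained d G₁ G₂
  rw [h]; exact cost_nonneg d hnonneg π

theorem ged_symm_le (d : α → α → ℝ) (hsymm : ∀ a b, d a b = d b a) (G₁ G₂ : LGraph α ε) :
    GED d G₂ G₁ ≤ GED d G₁ G₂ := by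
  obtain ⟨M, hM, h⟩ := ged_attained' d G₁ G₂
  have hmem : ∀ p : ℕ × ℕ, p ∈ M.image Prod.swap ↔ p.swap ∈ M := by
    rintro ⟨a, b⟩; simp
  have hM' : IsMatch G₂ G₁ (M.image Prod.swap) := by
    refine ⟨?_, ?_, ?_⟩
    · intro p hp
      have := Finset.mem_product.1 (hM.1 ((hmem p).1 hp))
      exact Finset.mem_product.2 ⟨this.2, this.1⟩
    · intro p hp q hq hpq
      exact Prod.swap_injective (hM.2.2 _ ((hmem p).1 hp) _ ((hmem q).1 hq) hpq)
    · intro p hp q hq hpq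
      exact Prod.swap_injective (hM.2.1 _ ((hmem p).1 hp) _ ((hmem q).1 hq) hpq)
  refine (ged_le d _ hM').trans (le_of_eq ?_)
  rw [h, totCost, totCost, relCost_swap ε d hsymm _ _ _ _ _ _ hmem,
    relCost_swap ε d hsymm G₁.E G₂.E G₁.Le G₂.Le (edgeRel G₁ G₂ M)
      (edgeRel G₂ G₁ (M.image Prod.swap))]
  rintro ⟨e, e'⟩
  simp only [mem_edgeRel, Prod.fst_swap, Prod.snd_swap, Prod.swap_prod_mk]
  constructor
  · rintro ⟨⟨a, b⟩, m, hm, n, hn, h1, h2⟩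
    exact ⟨⟨b, a⟩, m.swap, (hmem m).1 hm, n.swap, (hmem n).1 hn, h2, h1⟩
  · rintro ⟨⟨a, b⟩, m, hm, n, hn, h1, h2⟩
    exact ⟨⟨b, a⟩, m.swap, Finset.mem_image_of_mem _ hm, n.swap, Finset.mem_image_of_mem _ hn,
      h2, h1⟩

theorem ged_triangle (d : α → α → ℝ) (hnonneg : ∀ a b, 0 ≤ d a b)
    (hsymm : ∀ a b, d a b = d b a) (htri : ∀ a b c, d a c ≤ d a b + d b c)
    (G₁ G₂ G₃ : LGraph α ε) : GED d G₁ G₃ ≤ GED d G₁ G₂ + GED d G₂ G₃ := by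
  classical
  obtain ⟨M, hM, h⟩ := ged_attained' d G₁ G₂
  obtain ⟨N, hN, h'⟩ := ged_attained' d G₂ G₃
  let P := (G₁.V ×ˢ G₃.V).filter fun p => ∃ b, (p.1, b) ∈ M ∧ (b, p.2) ∈ N
  have hP : ∀ m ∈ M, ∀ n ∈ N, m.2 = n.1 → (m.1, n.2) ∈ P := by
    rintro ⟨a, b⟩ hm ⟨b', c⟩ hn hb
    simp only at hb
    subst hb
    exact Finset.mem_filter.2 ⟨Finset.mem_product.2 ⟨(Finset.mem_product.1 (hM.1 hm)).1,
      (Finset.mem_product.1 (hN.1 hn)).2⟩, b, hm, hn⟩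
  have hPM : IsMatch G₁ G₃ P := by
    refine ⟨Finset.filter_subset _ _, ?_, ?_⟩
    · rintro ⟨a, c⟩ hp ⟨a', c'⟩ hq hpq
      obtain ⟨_, b, h1, h2⟩ := Finset.mem_filter.1 hp
      obtain ⟨_, b', h1', h2'⟩ := Finset.mem_filter.1 hq
      simp only at h1 h2 h1' h2' hpq
      subst hpq
      have e1 := congrArg Prod.snd (hM.2.1 _ h1 _ h1' rfl)
      simp only at e1
      subst e1
      have e2 := congrArg Prod.snd (hN.2.1 _ h2 _ h2' rfl)
      simp only at e2
      rw [e2]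
    · rintro ⟨a, c⟩ hp ⟨a', c'⟩ hq hpq
      obtain ⟨_, b, h1, h2⟩ := Finset.mem_filter.1 hp
      obtain ⟨_, b', h1', h2'⟩ := Finset.mem_filter.1 hq
      simp only at h1 h2 h1' h2' hpq
      subst hpq
      have e1 := congrArg Prod.fst (hN.2.2 _ h2 _ h2' rfl)
      simp only at e1
      subst e1
      have e2 := congrArg Prod.fst (hM.2.2 _ h1 _ h1' rfl)
      simp only at e2
      rw [e2]
  have t1 := relCost_triangle ε d hnonneg hsymm htri G₁.V G₂.V G₃.V G₁.Lv G₂.Lv G₃.Lv M N P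
    hM.2 hN.2 (fun m hm => (Finset.mem_product.1 (hM.1 hm)).2)
    (fun m hm => (Finset.mem_product.1 (hN.1 hm)).1) hP
  have t2 := relCost_triangle ε d hnonneg hsymm htri G₁.E G₂.E G₃.E G₁.Le G₂.Le G₃.Le
    (edgeRel G₁ G₂ M) (edgeRel G₂ G₃ N) (edgeRel G₁ G₃ P)
    (edgeRel_pinj _ _ _ hM.2) (edgeRel_pinj _ _ _ hN.2)
    (fun m hm => ((mem_edgeRel _ _ _ _).1 hm).1.2)
    (fun m hm => ((mem_edgeRel _ _ _ _).1 hm).1.1) (by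
      rintro ⟨e, f⟩ hp ⟨f', g⟩ hq hpq
      rw [mem_edgeRel] at hp hq ⊢
      obtain ⟨⟨k1, k2⟩, m, hm, n, hn, h1, h2⟩ := hp
      obtain ⟨⟨k1', k2'⟩, m', hm', n', hn', h1', h2'⟩ := hq
      simp only at hpq h1 h2 h1' h2' k1 k2 k1' k2'
      refine ⟨⟨k1, k2'⟩, ?_⟩
      rw [h2, h1', Sym2.eq_iff] at hpq
      rcases hpq with ⟨a, b⟩ | ⟨a, b⟩
      · exact ⟨_, hP m hm m' hm' a, _, hP n hn n' hn' b, h1, h2'⟩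
      · exact ⟨_, hP m hm n' hn' a, _, hP n hn m' hm' b, h1, h2'.trans Sym2.eq_swap⟩)
  have := ged_le d P hPM
  rw [h, h']
  unfold totCost at *
  linarith

theorem iso_of_cost_zero (d : α → α → ℝ) (hnonneg : ∀ a b, 0 ≤ d a b)
    (hiff : ∀ a b, d a b = 0 ↔ a = b) {G₁ G₂ : LGraph α ε} (π : GMap G₁ G₂)
    (h : π.cost d = 0) : Isomorphic G₁ G₂ := by
  classical
  unfold GMap.cost at h
  rw [add_eq_zero_iff_of_nonneg, add_eq_zero_iff_of_nonneg, add_eq_zero_iff_of_nonneg,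
    add_eq_zero_iff_of_nonneg, add_eq_zero_iff_of_nonneg] at h
  rotate_left
  iterate 10
    (repeat' apply add_nonneg) <;> exact Finset.sum_nonneg fun i _ => hnonneg _ _
  obtain ⟨⟨⟨⟨⟨h1, h2⟩, h3⟩, h4⟩, h5⟩, h6⟩ := h
  rw [Finset.sum_eq_zero_iff_of_nonneg (fun i _ => hnonneg _ _)] at h1 h2 h3 h4 h5 h6
  simp only [hiff] at h1 h2 h3 h4 h5 h6
  have d1 : π.dom = G₁.V := by
    refine Finset.Subset.antisymm π.dom_sub fun v hv => ?_
    by_contra hc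
    exact G₁.Lv_ne v hv (h2 v (by simp [hv, hc]))
  have d2 : π.matchedEdges = G₁.E := by
    refine Finset.Subset.antisymm (Finset.filter_subset _ _) fun v hv => ?_
    by_contra hc
    exact G₁.Le_ne v hv (h5 v (by simp only [Finset.mem_sdiff]; exact ⟨hv, hc⟩))
  refine ⟨π.f, ?_, ?_, ?_, ?_, ?_⟩
  · intro a ha b hb hab
    rw [← d1] at ha hb
    exact π.injOn a ha b hb hab
  · ext w
    constructor
    · intro hw
      obtain ⟨v, hv, rfl⟩ := Finset.mem_image.1 hw
      exact π.maps_to v (d1 ▸ hv)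
    · intro hw
      by_contra hc
      refine G₂.Lv_ne w hw (h3 w ?_).symm
      rw [Finset.mem_sdiff]
      refine ⟨hw, fun hh => hc ?_⟩
      rw [← d1]
      rw [Finset.mem_image] at hh ⊢
      exact hh
  · intro v hv
    exact (h1 v (d1 ▸ hv)).symm
  · ext w
    constructor
    · intro hw
      obtain ⟨v, hv, rfl⟩ := Finset.mem_image.1 hw
      rw [← d2] at hv
      exact (Finset.mem_filter.1 hv).2.2
    · intro hw
      by_contra hc
      refine G₂.Le_ne w hw (h6 w ?_).symm
      rw [Finset.mem_sdiff]
      refine ⟨hw, fun hh => hc ?_⟩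
      rw [← d2]
      rw [Finset.mem_image] at hh ⊢
      exact hh
  · intro v hv
    exact (h4 v (d2 ▸ hv)).symm

theorem cost_zero_of_iso (d : α → α → ℝ)
    (hiff : ∀ a b, d a b = 0 ↔ a = b) {G₁ G₂ : LGraph α ε} (h : Isomorphic G₁ G₂) :
    ∃ π : GMap G₁ G₂, π.cost d = 0 := by
  classical
  obtain ⟨g, g1, g2, g3, g4, g5⟩ := h
  let π : GMap G₁ G₂ := ⟨G₁.V, Finset.Subset.refl _, g,
    fun v hv => g2 ▸ Finset.mem_image_of_mem g hv, fun v hv w hw h => g1 hv hw h⟩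
  have hme : π.matchedEdges = G₁.E := by
    refine Finset.Subset.antisymm (Finset.filter_subset _ _) fun e he => ?_
    refine Finset.mem_filter.2 ⟨he, fun v hv => G₁.edge_mem e he v hv, ?_⟩
    rw [← g4]; exact Finset.mem_image_of_mem _ he
  refine ⟨π, ?_⟩
  unfold GMap.cost
  have s1 : ∑ v ∈ π.dom, d (G₁.Lv v) (G₂.Lv (π.f v)) = 0 :=
    Finset.sum_eq_zero fun v hv => (hiff _ _).2 (g3 v hv).symm
  have s4 : ∑ e ∈ π.matchedEdges, d (G₁.Le e) (G₂.Le (e.map π.f)) = 0 :=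
    Finset.sum_eq_zero fun v hv => (hiff _ _).2 (g5 v (hme ▸ hv)).symm
  rw [s1, s4]
  simp only [zero_add, add_zero]
  have aux : ∀ x y z w : ℝ, x = 0 → y = 0 → z = 0 → w = 0 → x + y + z + w = 0 := by
    intros; linarith
  apply aux
  · apply Finset.sum_eq_zero
    intro v hv
    exact ((Finset.mem_sdiff.1 hv).2 (Finset.mem_sdiff.1 hv).1).elim
  · apply Finset.sum_eq_zero
    intro v hv
    obtain ⟨a, b⟩ := Finset.mem_sdiff.1 hv
    refine (b ?_).elim
    rw [← g2, Finset.mem_image] at a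
    rw [Finset.mem_image]
    exact a
  · apply Finset.sum_eq_zero
    intro v hv
    obtain ⟨a, b⟩ := Finset.mem_sdiff.1 hv
    exact (b (hme ▸ a)).elim
  · apply Finset.sum_eq_zero
    intro v hv
    obtain ⟨a, b⟩ := Finset.mem_sdiff.1 hv
    refine (b ?_).elim
    rw [← g4, Finset.mem_image] at a
    rw [Finset.mem_image, hme]
    exact a

theorem ged_zero_iff (d : α → α → ℝ) (hnonneg : ∀ a b, 0 ≤ d a b)
    (hiff : ∀ a b, d a b = 0 ↔ a = b) (G₁ G₂ : LGraph α ε) :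
    GED d G₁ G₂ = 0 ↔ Isomorphic G₁ G₂ := by
  constructor
  · intro h
    obtain ⟨π, hπ⟩ := ged_attained d G₁ G₂
    exact iso_of_cost_zero d hnonneg hiff π (hπ.symm.trans h)
  · intro h
    obtain ⟨π, hπ⟩ := cost_zero_of_iso d hiff h
    refine le_antisymm ?_ (ged_nonneg d hnonneg G₁ G₂)
    rw [← hπ]
    exact csInf_le (cost_set_finite d G₁ G₂).bddBelow ⟨π, rfl⟩

end GEDProof

/-- If the label cost `d` is a metric on the label set, then `GED` is a
metric on labelled graphs (up to isomorphism): nonnegativity, identity of indiscernibles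
(up to isomorphism), symmetry, and the triangle inequality.  In particular this holds for
the binary cost, which is a metric. -/
theorem ged_is_metric {α : Type} {ε : α} (d : α → α → ℝ)
    (hnonneg : ∀ a b, 0 ≤ d a b) (hiff : ∀ a b, d a b = 0 ↔ a = b)
    (hsymm : ∀ a b, d a b = d b a) (htri : ∀ a b c, d a c ≤ d a b + d b c)
    (G₁ G₂ G₃ : LGraph α ε) :
    0 ≤ GED d G₁ G₂ ∧ (GED d G₁ G₂ = 0 ↔ Isomorphic G₁ G₂) ∧
      GED d G₁ G₂ = GED d G₂ G₁ ∧ GED d G₁ G₃ ≤ GED d G₁ G₂ + GED d G₂ G₃ := by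
  exact ⟨GEDProof.ged_nonneg d hnonneg G₁ G₂, GEDProof.ged_zero_iff d hnonneg hiff G₁ G₂,
    le_antisymm (GEDProof.ged_symm_le d hsymm G₂ G₁) (GEDProof.ged_symm_le d hsymm G₁ G₂),
    GEDProof.ged_triangle d hnonneg hsymm htri G₁ G₂ G₃⟩
end

section
/- Let N be a norm on ℝⁿ that is monotonic, i.e. whenever |xᵢ| ≤ |yᵢ| for all i one has N(x) ≤ N(y), and define F_N(x, y) = N(ReLU(x − y)). Then F_N satisfies the triangle inequality: for all x, y, z ∈ ℝⁿ, F_N(x, z) ≤ F_N(x, y) + F_N(y, z). -/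
/-- Coordinatewise ReLU on `ℝⁿ`. -/
noncomputable def reluV {n : ℕ} (x : Fin n → ℝ) : Fin n → ℝ :=
  fun i => max (x i) 0

/-- For any monotonic norm `N` on `ℝⁿ`, the prediction function
`F_N(x, y) = N(ReLU(x − y))` satisfies the triangle inequality. -/
theorem monotonic_norm_predF_triangle {n : ℕ} (N : (Fin n → ℝ) → ℝ)
    (hnonneg : ∀ x, 0 ≤ N x) (hdef : ∀ x, N x = 0 ↔ x = 0)
    (hhomog : ∀ (c : ℝ) (x), N (c • x) = |c| * N x)
    (hsubadd : ∀ x y, N (x + y) ≤ N x + N y)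
    (hmono : ∀ x y : Fin n → ℝ, (∀ i, |x i| ≤ |y i|) → N x ≤ N y)
    (x y z : Fin n → ℝ) :
    N (reluV (x - z)) ≤ N (reluV (x - y)) + N (reluV (y - z)) := by
  refine le_trans (hmono _ _ fun i => ?_) (hsubadd _ _)
  simp only [reluV, Pi.add_apply, Pi.sub_apply]
  have h1 := le_max_left (x i - y i) 0
  have h2 := le_max_right (x i - y i) 0
  have h3 := le_max_left (y i - z i) 0
  have h4 := le_max_right (y i - z i) 0
  rw [abs_of_nonneg (le_max_right _ _), abs_of_nonneg (add_nonneg h2 h4)]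
  exact max_le (by linarith) (by linarith)
end
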